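/- Let S ⊆ K with |S| ≥ 2 and let k ∈ S. Then the difference of the maximum matching weights with and without user k is bounded by w(M*_S) − w(M*_{S∖{k}}) ≤ max_{i,j ∈ S∖{k}} (α_{ik} + α_{kj} − α'_{ij}), where i and j range over S∖{k} and may be equal. -/

import Mathlib

noncomputable def alphaP {ι : Type*} [DecidableEq ι] (α : ι → ι → ℝ) (i j : ι) : ℝ :=
  if i = j then 0 else α i j

/-- A matching of the complete bipartite graph on `S × S`: a set of pairs in which no two
pairs share the same first coordinate and no two pairs share the same second coordinate. -/
def IsMatching {ι : Type*} (S : Finset ι) (M : Finset (ι × ι)) : Prop :=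
  M ⊆ S ×ˢ S ∧
  (∀ p ∈ M, ∀ q ∈ M, p.1 = q.1 → p = q) ∧
  (∀ p ∈ M, ∀ q ∈ M, p.2 = q.2 → p = q)

/-- The maximum weight `w(M*_S)` of a matching of the complete bipartite graph on `S × S`
with weights `α'` (the empty matching is allowed, so `w(M*_S) = 0` when `|S| ≤ 1`
whenever `α'` has zero diagonal and is nonnegative). -/
noncomputable def wStar {ι : Type*} [DecidableEq ι] (α' : ι → ι → ℝ) (S : Finset ι) : ℝ :=
  letI := Classical.propDecidable
  ((S ×ˢ S).powerset.filter (fun M => IsMatching S M)).sup'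
    ⟨∅, by simp [IsMatching, Finset.mem_filter]⟩ (fun M => ∑ p ∈ M, α' p.1 p.2)

/-- The matching-form polyhedral TIN-achievable region `P^TINA_S`. -/
noncomputable def TINA {ι : Type*} [DecidableEq ι] (α : ι → ι → ℝ) (S : Finset ι)
    (d : ι → ℝ) : Prop :=
  (∀ i ∉ S, d i = 0) ∧ (∀ k ∈ S, 0 ≤ d k) ∧
  ∀ S' ⊆ S, S'.Nonempty → ∑ k ∈ S', d k ≤ ∑ k ∈ S', α k k - wStar (alphaP α) S'

/-- Condition (C1): for every `k`, `α_{kk} ≥ α_{ik} + α_{kj} − α'_{ij}` for all `i ≠ k`,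
`j ≠ k`. -/
def CondC1 {ι : Type*} [DecidableEq ι] (α : ι → ι → ℝ) : Prop :=
  ∀ k i j : ι, i ≠ k → j ≠ k → α i k + α k j - alphaP α i j ≤ α k k

/-- Condition (C2): every subset of size `> 2` admits a maximum-weight matching containing
a zero-strength pair. -/
def CondC2 {ι : Type*} [DecidableEq ι] (α : ι → ι → ℝ) : Prop :=
  ∀ S' : Finset ι, 2 < S'.card →
    ∃ M : Finset (ι × ι), IsMatching S' M ∧
      (∑ p ∈ M, alphaP α p.1 p.2) = wStar (alphaP α) S' ∧
      ∃ p ∈ M, α p.1 p.2 = 0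

theorem alphaP_self {ι : Type*} [DecidableEq ι] (α : ι → ι → ℝ) (i : ι) : alphaP α i i = 0 := by
  simp [alphaP]

theorem alphaP_of_ne {ι : Type*} [DecidableEq ι] (α : ι → ι → ℝ) {i j : ι} (h : i ≠ j) :
    alphaP α i j = α i j := by
  simp [alphaP, h]

theorem alphaP_nonneg {ι : Type*} [DecidableEq ι] {α : ι → ι → ℝ} (hα : ∀ i j, 0 ≤ α i j)
    (i j : ι) : 0 ≤ alphaP α i j := by
  unfold alphaP
  split_ifs
  exacts [le_rfl, hα i j]

theorem IsMatching.sum_le_wStar {ι : Type*} [DecidableEq ι] {S : Finset ι} {M : Finset (ι × ι)}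
    (hM : IsMatching S M) (w : ι → ι → ℝ) : ∑ p ∈ M, w p.1 p.2 ≤ wStar w S := by
  classical
  unfold wStar
  exact Finset.le_sup' (fun M : Finset (ι × ι) => ∑ p ∈ M, w p.1 p.2)
    (by simpa [hM] using hM.1)

theorem exists_isMatching_wStar_eq {ι : Type*} [DecidableEq ι] (w : ι → ι → ℝ) (S : Finset ι) :
    ∃ M, IsMatching S M ∧ wStar w S = ∑ p ∈ M, w p.1 p.2 := by
  classical
  unfold wStar
  obtain ⟨M, hM, h⟩ := Finset.exists_mem_eq_sup'
    (s := (S ×ˢ S).powerset.filter (fun M => IsMatching S M))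
    ⟨∅, by simp [IsMatching, Finset.mem_filter]⟩ (fun M => ∑ p ∈ M, w p.1 p.2)
  exact ⟨M, (Finset.mem_filter.mp hM).2, by convert h⟩

/-- The graph of a permutation preserving `S` is a matching on `S × S`. -/
theorem sum_perm_le_wStar {ι : Type*} [DecidableEq ι] (w : ι → ι → ℝ) {S : Finset ι}
    (σ : Equiv.Perm ι) (hσ : ∀ i ∈ S, σ i ∈ S) : ∑ i ∈ S, w i (σ i) ≤ wStar w S := by
  have hM : IsMatching S (S.image fun i => (i, σ i)) := by
    refine ⟨?_, ?_, ?_⟩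
    · intro p hp
      obtain ⟨i, hi, rfl⟩ := Finset.mem_image.mp hp
      exact Finset.mk_mem_product hi (hσ i hi)
    all_goals
      intro p hp q hq h
      obtain ⟨i, hi, rfl⟩ := Finset.mem_image.mp hp
      obtain ⟨j, hj, rfl⟩ := Finset.mem_image.mp hq
      simpa using h
  refine le_trans (le_of_eq ?_) (hM.sum_le_wStar w)
  rw [Finset.sum_image fun i _ j _ h => congrArg Prod.fst h]

/-- Every matching on `S × S` extends to a perfect matching. -/
theorem IsMatching.exists_perm {ι : Type*} [DecidableEq ι] {S : Finset ι} {M : Finset (ι × ι)}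
    (hM : IsMatching S M) :
    ∃ σ : Equiv.Perm ι, (∀ i ∈ S, σ i ∈ S) ∧ ∀ p ∈ M, σ p.1 = p.2 := by
  classical
  obtain ⟨hS, h_fst, h_snd⟩ := hM
  have hex : ∀ i : ι, ∃ j, i ∈ M.image Prod.fst → (i, j) ∈ M := by
    intro i
    by_cases hi : i ∈ M.image Prod.fst
    · obtain ⟨p, hp, rfl⟩ := Finset.mem_image.mp hi
      exact ⟨p.2, fun _ => hp⟩
    · exact ⟨i, fun h => absurd h hi⟩
  choose f hf using hex
  obtain ⟨g, hg⟩ := Finset.exists_equiv_extend_of_card_eq (α := S) (t := S) (by simp)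
    (s := Finset.univ.filter fun i : S => (i : ι) ∈ M.image Prod.fst) (f := fun i => f i)
    (by
      intro j hj
      obtain ⟨i, hi, rfl⟩ := Finset.mem_image.mp hj
      exact (Finset.mem_product.mp (hS (hf i (Finset.mem_filter.mp hi).2))).2)
    (by
      intro i hi j hj h
      have hi' := hf i (Finset.mem_filter.mp hi).2
      have hj' := hf j (Finset.mem_filter.mp hj).2
      exact Subtype.ext (congrArg Prod.fst (h_snd _ hi' _ hj' h)))
  refine ⟨Equiv.Perm.ofSubtype (p := (· ∈ S)) g, fun i hi => ?_, fun p hp => ?_⟩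
  · rw [Equiv.Perm.ofSubtype_apply_of_mem (p := (· ∈ S)) g hi]
    exact (g ⟨i, hi⟩).2
  · have hpS := (Finset.mem_product.mp (hS hp)).1
    have hpM := Finset.mem_image_of_mem Prod.fst hp
    rw [Equiv.Perm.ofSubtype_apply_of_mem (p := (· ∈ S)) g hpS,
      hg ⟨p.1, hpS⟩ (Finset.mem_filter.mpr ⟨Finset.mem_univ _, hpM⟩)]
    exact congrArg Prod.snd (h_fst _ (hf p.1 hpM) _ hp rfl)

theorem exists_perm_wStar_le {ι : Type*} [DecidableEq ι] {w : ι → ι → ℝ}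
    (hw : ∀ i j, 0 ≤ w i j) (S : Finset ι) :
    ∃ σ : Equiv.Perm ι, (∀ i ∈ S, σ i ∈ S) ∧ wStar w S ≤ ∑ i ∈ S, w i (σ i) := by
  obtain ⟨M, hM, h⟩ := exists_isMatching_wStar_eq w S
  obtain ⟨σ, hσS, hσM⟩ := hM.exists_perm
  refine ⟨σ, hσS, ?_⟩
  have hinj : Set.InjOn Prod.fst (M : Set (ι × ι)) := fun p hp q hq => hM.2.1 p hp q hq
  calc wStar w S = ∑ p ∈ M, w p.1 (σ p.1) := by
        rw [h]
        exact Finset.sum_congr rfl fun p hp => by rw [hσM p hp]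
    _ = ∑ i ∈ M.image Prod.fst, w i (σ i) := (Finset.sum_image (f := fun i => w i (σ i)) hinj).symm
    _ ≤ ∑ i ∈ S, w i (σ i) := by
        refine Finset.sum_le_sum_of_subset_of_nonneg ?_ fun i _ _ => hw _ _
        intro i hi
        obtain ⟨p, hp, rfl⟩ := Finset.mem_image.mp hi
        exact (Finset.mem_product.mp (hM.1 hp)).1

/-- For `|S| ≥ 2` and `k ∈ S`, the difference of the maximum matching
weights with and without user `k` is bounded by
`w(M*_S) − w(M*_{S∖{k}}) ≤ max_{i,j ∈ S∖{k}} (α_{ik} + α_{kj} − α'_{ij})`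
(`i` and `j` may be equal). -/
theorem wStar_diff_le {ι : Type*} [Fintype ι] [DecidableEq ι]
    (α : ι → ι → ℝ) (hα : ∀ i j, 0 ≤ α i j)
    (S : Finset ι) (hS : 2 ≤ S.card) (k : ι) (hk : k ∈ S) :
    wStar (alphaP α) S - wStar (alphaP α) (S.erase k) ≤
      ((S.erase k) ×ˢ (S.erase k)).sup'
        (Finset.Nonempty.product
          (Finset.card_pos.mp (by rw [Finset.card_erase_of_mem hk]; omega))
          (Finset.card_pos.mp (by rw [Finset.card_erase_of_mem hk]; omega)))
        (fun p => α p.1 k + α k p.2 - alphaP α p.1 p.2) := by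
  obtain ⟨σ, hσ, hle⟩ := exists_perm_wStar_le (alphaP_nonneg hα) S
  suffices ∃ p ∈ (S.erase k) ×ˢ (S.erase k), wStar (alphaP α) S - wStar (alphaP α) (S.erase k) ≤
      α p.1 k + α k p.2 - alphaP α p.1 p.2 by
    obtain ⟨p, hp, h⟩ := this
    exact h.trans (Finset.le_sup' (fun p => α p.1 k + α k p.2 - alphaP α p.1 p.2) hp)
  rw [← Finset.add_sum_erase _ _ hk] at hle
  by_cases hfix : σ k = k
  · obtain ⟨i, hi⟩ : (S.erase k).Nonempty :=
      Finset.card_pos.mp (by rw [Finset.card_erase_of_mem hk]; omega)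
    refine ⟨(i, i), Finset.mk_mem_product hi hi, ?_⟩
    have hsum := sum_perm_le_wStar (S := S.erase k) (alphaP α) σ fun j hj =>
      Finset.mem_erase.mpr ⟨fun h => Finset.ne_of_mem_erase hj (σ.injective (h.trans hfix.symm)),
        hσ j (Finset.mem_of_mem_erase hj)⟩
    rw [hfix, alphaP_self] at hle
    simp only [alphaP_self]
    linarith [hα i k, hα k i]
  · obtain ⟨i, hiS, hi⟩ : ∃ i ∈ S, σ i = k :=
      Finset.surjOn_of_injOn_of_card_le σ hσ σ.injective.injOn le_rfl hk
    have hik : i ≠ k := fun h => hfix (h ▸ hi)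
    have hiE : i ∈ S.erase k := Finset.mem_erase.mpr ⟨hik, hiS⟩
    refine ⟨(i, σ k), Finset.mk_mem_product hiE (Finset.mem_erase.mpr ⟨hfix, hσ k hk⟩), ?_⟩
    have hne : ∀ j ∈ S.erase k, j ≠ i → σ j ≠ k := fun j _ hji h =>
      hji (σ.injective (h.trans hi.symm))
    have hswap : ∀ j ∈ S.erase k, j ≠ i → (Equiv.swap (σ k) k * σ) j = σ j := fun j hj hji =>
      Equiv.swap_apply_of_ne_of_ne
        (fun h => Finset.ne_of_mem_erase hj (σ.injective h)) (hne j hj hji)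
    have hswapi : (Equiv.swap (σ k) k * σ) i = σ k := by simp [hi]
    have hsum := sum_perm_le_wStar (S := S.erase k) (alphaP α) (Equiv.swap (σ k) k * σ) (by
      intro j hj
      by_cases hji : j = i
      · rw [hji, hswapi]
        exact Finset.mem_erase.mpr ⟨hfix, hσ k hk⟩
      · rw [hswap j hj hji]
        exact Finset.mem_erase.mpr ⟨hne j hj hji, hσ j (Finset.mem_of_mem_erase hj)⟩)
    rw [← Finset.add_sum_erase _ _ hiE, hswapi, Finset.sum_congr rfl fun j hj => by
      rw [hswap j (Finset.mem_of_mem_erase hj) (Finset.ne_of_mem_erase hj)]] at hsum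
    rw [← Finset.add_sum_erase _ _ hiE, hi, alphaP_of_ne α hik,
      alphaP_of_ne α (Ne.symm hfix)] at hle
    dsimp only
    linarith
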